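/- Suppose the input maps X^in(i,j), 1 ≤ i < j ≤ n, are generated according to the random corruption model, and let α, β be parameters independent of n and d with 0 < α ≤ β ≤ 2. Assume p_true²/β + (1/α − 1/β)p_true + (1/2 − 1/α) > 0, p_true ≥ 1/4, n² > 12d, and d = d(n) satisfies d(n)⁴ log(n)/n → 0. Then with probability tending to 1 as n → ∞, condition (C3) holds strictly: for all t,q ∈ [d] and all 1 ≤ i < j ≤ n with a_tt(i,j) = a_qq(i,j) = −1 and a_tq(i,j) = 1, both κ_t(i,j) + (δ_{t→q}^{i→j} + δ_{q→t}^{j→i})/2 > 0 and κ_q(i,j) + (δ_{t→q}^{i→j} + δ_{q→t}^{j→i})/2 > 0. -/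

import Mathlib

open Matrix
open scoped Classical

noncomputable section

/-- The permutation matrix of a permutation `σ` of `Fin d`. -/
def permMat (d : ℕ) (σ : Equiv.Perm (Fin d)) : Matrix (Fin d) (Fin d) ℝ :=
  Matrix.of fun t q => if σ q = t then 1 else 0

/-- The objective function of the basic LP (P):
`∑_{i<j} ∑_{t,q} a_{tq}(i,j) X_{tq}(i,j)`. -/
def lpObj (n d : ℕ) (a X : Fin n → Fin n → Matrix (Fin d) (Fin d) ℝ) : ℝ :=
  ∑ p ∈ Finset.univ.filter (fun p : Fin n × Fin n => p.1 < p.2),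
    ∑ t : Fin d, ∑ q : Fin d, a p.1 p.2 t q * X p.1 p.2 t q

/-- The feasible region of the basic LP (P): all row and column sums equal one,
the triangle inequalities hold, and all entries are nonnegative. -/
def lpFeasible (n d : ℕ) (X : Fin n → Fin n → Matrix (Fin d) (Fin d) ℝ) : Prop :=
  (∀ i j : Fin n, i < j → ∀ t : Fin d, ∑ q : Fin d, X i j t q = 1) ∧
  (∀ i j : Fin n, i < j → ∀ q : Fin d, ∑ t : Fin d, X i j t q = 1) ∧
  (∀ i j k : Fin n, i < j → j < k → ∀ l t q : Fin d,
      X i j l t + X j k t q - X i k l q ≤ 1 ∧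
      X i j l t - X j k t q + X i k l q ≤ 1 ∧
      - X i j l t + X j k t q + X i k l q ≤ 1) ∧
  (∀ i j : Fin n, i < j → ∀ t q : Fin d, 0 ≤ X i j t q)

/-- The quantity `δ_{t→q}^{i→j}` of the dual certificate. -/
def deltaJOM (n d : ℕ) (a : Fin n → Fin n → Matrix (Fin d) (Fin d) ℝ) (α β : ℝ)
    (i j : Fin n) (t q : Fin d) : ℝ :=
  (1 / (n : ℝ)) *
    ∑ k ∈ Finset.univ.filter (fun k : Fin n => k ≠ i ∧ k ≠ j ∧ a k i t t = -1),
      ((a k j t q - a i j t q) / α + (a i j t t - a k j t t) / (β * d))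

/-- The quantity `κ_t(i,j)` of the dual certificate. -/
def kappaJOM (n d : ℕ) (a : Fin n → Fin n → Matrix (Fin d) (Fin d) ℝ) (α β : ℝ)
    (i j : Fin n) (t : Fin d) : ℝ :=
  (1 / (n : ℝ)) *
      ∑ l ∈ Finset.univ.filter (fun l : Fin d => l ≠ t),
        ∑ k ∈ Finset.univ.filter (fun k : Fin n => k ≠ i ∧ k ≠ j),
          min (a k i l t / α + a k j t t / (β * d)) (a k j l t / α + a k i t t / (β * d))
    + (1 / (n : ℝ)) * (1 / (2 * α) - ((d : ℝ) - 1) / (2 * β * d)) *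
        ((∑ k ∈ Finset.univ.filter (fun k : Fin n => k ≠ i), a k i t t) +
          ∑ k ∈ Finset.univ.filter (fun k : Fin n => k ≠ j), a k j t t)
    - ((d : ℝ) - 2) / α + 1
    + (1 / (2 * (n : ℝ))) *
        ∑ l ∈ Finset.univ.filter (fun l : Fin d => l ≠ t),
          ((a i j t l + a j i t l) / α + 2 * a i j t t / (β * d))

/-- A sample of the random corruption model: for each (ordered) pair of objects, a
Bernoulli coin and a uniformly random permutation. -/
abbrev Sample (n d : ℕ) := Fin n → Fin n → Bool × Equiv.Perm (Fin d)

/-- The probability weight of a sample: each coin is heads with probability `p`, each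
permutation is uniform among the `d!` permutations, all independently. -/
def wtJOM (n d : ℕ) (p : ℝ) (ω : Sample n d) : ℝ :=
  ∏ i : Fin n, ∏ j : Fin n,
    ((if (ω i j).1 then p else 1 - p) / (Nat.factorial d : ℝ))

/-- The probability of an event under the random corruption model. -/
def prJOM (n d : ℕ) (p : ℝ) (E : Sample n d → Prop) : ℝ :=
  ∑ ω : Sample n d, if E ω then wtJOM n d p ω else 0

/-- The random input map for a pair `i < j`: the identity (ground truth) if the coin
shows heads, and an independent uniformly random permutation matrix otherwise. -/
def baseMat (n d : ℕ) (ω : Sample n d) (i j : Fin n) : Matrix (Fin d) (Fin d) ℝ :=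
  if (ω i j).1 then 1 else permMat d (ω i j).2

/-- The full collection of random input maps, extended by transposition:
`X^in(j,i) = X^in(i,j)ᵀ`. -/
def XinRand (n d : ℕ) (ω : Sample n d) (i j : Fin n) : Matrix (Fin d) (Fin d) ℝ :=
  if i < j then baseMat n d ω i j else if j < i then (baseMat n d ω j i)ᵀ else 1

/-- The random coefficients `a_{tq}(i,j) = 1 - 2 X^in_{tq}(i,j)`. -/
def aRand (n d : ℕ) (ω : Sample n d) (i j : Fin n) : Matrix (Fin d) (Fin d) ℝ :=
  Matrix.of fun t q => 1 - 2 * XinRand n d ω i j t q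


section aux
set_option linter.unusedSimpArgs false

theorem aux_factor {ι κ Ω : Type} [Fintype ι] [DecidableEq ι] [Fintype κ] [Fintype Ω]
    (w : Ω → ℝ) (hw : ∑ x, w x = 1) (e : κ × Bool → ι) (he : Function.Injective e)
    (h : κ → Ω → Ω → ℝ) :
    ∑ ω : ι → Ω, (∏ i, w (ω i)) * ∏ k, h k (ω (e (k, true))) (ω (e (k, false)))
      = ∏ k, ∑ x, ∑ y, w x * w y * h k x y := by
  let E : (κ × Bool) ⊕ {x // x ∉ Set.range e} ≃ ι :=
    ((Equiv.ofInjective e he).sumCongr (Equiv.refl _)).trans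
      (Equiv.sumCompl (fun x => x ∈ Set.range e))
  have hEl : ∀ a, E (Sum.inl a) = e a := by intro a; simp [E]
  let G : ((κ → Bool → Ω) × ({x // x ∉ Set.range e} → Ω)) ≃ (ι → Ω) :=
    (((Equiv.curry κ Bool Ω).symm.prodCongr (Equiv.refl _)).trans
      (Equiv.sumArrowEquivProdArrow _ _ _).symm).trans (E.arrowCongr (Equiv.refl _))
  have hGl : ∀ g r a b, G (g, r) (e (a, b)) = g a b := by
    intro g r a b
    rw [← hEl]
    simp [G, Equiv.arrowCongr, Equiv.sumArrowEquivProdArrow]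
  have hGr : ∀ g r x, G (g, r) (E (Sum.inr x)) = r x := by
    intro g r x
    simp [G, Equiv.arrowCongr, Equiv.sumArrowEquivProdArrow]
  rw [← G.sum_comp, Fintype.sum_prod_type]
  have h1 : ∀ g r, (∏ i, w (G (g, r) i)) * ∏ k, h k (G (g, r) (e (k, true))) (G (g, r) (e (k, false)))
      = (∏ k, (w (g k true) * w (g k false) * h k (g k true) (g k false))) * ∏ x, w (r x) := by
    intro g r
    rw [← E.prod_comp, Fintype.prod_sum_type, Fintype.prod_prod_type]
    simp only [hEl, hGl, hGr, Fintype.prod_bool, Finset.prod_mul_distrib]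
    ring
  simp only [h1]
  simp only [← Finset.mul_sum]
  have h2 : ∑ r : {x // x ∉ Set.range e} → Ω, ∏ x, w (r x) = 1 := by
    have := Finset.prod_univ_sum (fun _ : {x // x ∉ Set.range e} => (Finset.univ : Finset Ω))
      (fun _ x => w x)
    simp only [hw, Finset.prod_const_one, Fintype.piFinset_univ] at this
    exact this.symm
  rw [h2]
  simp only [mul_one]
  have h3 := Finset.prod_univ_sum (fun _ : κ => (Finset.univ : Finset (Bool → Ω)))
      (fun k v => w (v true) * w (v false) * h k (v true) (v false))
  simp only [Fintype.piFinset_univ] at h3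
  rw [← h3]
  refine Finset.prod_congr rfl fun k _ => ?_
  rw [← (Equiv.boolArrowEquivProd Ω).symm.sum_comp, Fintype.sum_prod_type, Finset.sum_comm]
  simp [Equiv.boolArrowEquivProd]

theorem aux_chernoff {ι κ Ω : Type} [Fintype ι] [DecidableEq ι] [Fintype κ] [Fintype Ω]
    (w : Ω → ℝ) (hw : ∑ x, w x = 1) (hw0 : ∀ x, 0 ≤ w x)
    (e : κ × Bool → ι) (he : Function.Injective e)
    (Z : κ → Ω → Ω → ℝ) (C μ : ℝ) (hμ : 0 < μ) (hC : 0 < C) (hμC : μ ≤ C)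
    (hZC : ∀ k x y, |μ / 2 - Z k x y| ≤ C)
    (hE : ∀ k, μ ≤ ∑ x, ∑ y, w x * w y * Z k x y) :
    ∑ ω : ι → Ω, (if ∑ k, Z k (ω (e (k, true))) (ω (e (k, false))) ≤ Fintype.card κ * (μ / 2)
        then ∏ i, w (ω i) else 0) ≤ (1 - μ ^ 2 / (16 * C ^ 2)) ^ Fintype.card κ := by
  set lam := μ / (4 * C ^ 2) with hlam
  have hlam0 : 0 < lam := by positivity
  have hlC : lam * C ≤ 1 := by
    rw [hlam, div_mul_eq_mul_div, div_le_one (by positivity)]; nlinarith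
  have hww : ∑ x, ∑ y, w x * w y = 1 := by
    rw [← Finset.sum_mul_sum, hw, one_mul]
  calc _ ≤ ∑ ω : ι → Ω, (∏ i, w (ω i)) *
        ∏ k, Real.exp (lam * (μ / 2 - Z k (ω (e (k, true))) (ω (e (k, false))))) := by
        refine Finset.sum_le_sum fun ω _ => ?_
        have h0 : 0 ≤ ∏ i, w (ω i) := Finset.prod_nonneg fun i _ => hw0 _
        split_ifs with hc
        · rw [← Real.exp_sum]
          refine le_mul_of_one_le_right h0 (Real.one_le_exp ?_)
          rw [← Finset.mul_sum, Finset.sum_sub_distrib]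
          simp only [Finset.sum_const, Finset.card_univ, nsmul_eq_mul]
          refine mul_nonneg hlam0.le (by linarith)
        · exact mul_nonneg h0 (Finset.prod_nonneg fun _ _ => (Real.exp_pos _).le)
    _ = ∏ k, ∑ x, ∑ y, w x * w y * Real.exp (lam * (μ / 2 - Z k x y)) :=
        aux_factor w hw e he (fun k x y => Real.exp (lam * (μ / 2 - Z k x y)))
    _ ≤ ∏ k : κ, (1 - μ ^ 2 / (16 * C ^ 2)) := by
        refine Finset.prod_le_prod (fun k _ => Finset.sum_nonneg fun x _ =>
          Finset.sum_nonneg fun y _ => mul_nonneg (mul_nonneg (hw0 _) (hw0 _)) (Real.exp_pos _).le)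
          fun k _ => ?_
        have hb : ∀ x y, Real.exp (lam * (μ / 2 - Z k x y)) ≤
            1 + lam * (μ / 2) + lam ^ 2 * C ^ 2 - lam * Z k x y := by
          intro x y
          have h1 : |lam * (μ / 2 - Z k x y)| ≤ 1 := by
            rw [abs_mul, abs_of_pos hlam0]
            exact (mul_le_mul_of_nonneg_left (hZC k x y) hlam0.le).trans hlC
          have h2 := (abs_le.1 (Real.abs_exp_sub_one_sub_id_le h1)).2
          have h3 : (lam * (μ / 2 - Z k x y)) ^ 2 ≤ lam ^ 2 * C ^ 2 := by
            rw [mul_pow]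
            exact mul_le_mul_of_nonneg_left (sq_le_sq' (abs_le.1 (hZC k x y)).1 (abs_le.1 (hZC k x y)).2) (sq_nonneg _)
          linarith
        calc _ ≤ ∑ x, ∑ y, w x * w y * (1 + lam * (μ / 2) + lam ^ 2 * C ^ 2 - lam * Z k x y) :=
              Finset.sum_le_sum fun x _ => Finset.sum_le_sum fun y _ =>
                mul_le_mul_of_nonneg_left (hb x y) (mul_nonneg (hw0 _) (hw0 _))
          _ = (1 + lam * (μ / 2) + lam ^ 2 * C ^ 2) - lam * ∑ x, ∑ y, w x * w y * Z k x y := by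
              have : ∀ x y, w x * w y * (1 + lam * (μ / 2) + lam ^ 2 * C ^ 2 - lam * Z k x y)
                = (1 + lam * (μ / 2) + lam ^ 2 * C ^ 2) * (w x * w y) - lam * (w x * w y * Z k x y) := by
                intros; ring
              simp only [this, Finset.sum_sub_distrib, ← Finset.mul_sum, hww, mul_one]
              simp only [Finset.mul_sum] at hww ⊢
              simp only [← Finset.mul_sum, hww, hw, mul_one]
          _ ≤ (1 + lam * (μ / 2) + lam ^ 2 * C ^ 2) - lam * μ := by
              have := mul_le_mul_of_nonneg_left (hE k) hlam0.le
              linarith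
          _ = 1 - μ ^ 2 / (16 * C ^ 2) := by
              rw [hlam]; field_simp; ring
    _ = _ := by simp

def cwJ (d : ℕ) (p : ℝ) (c : Bool × Equiv.Perm (Fin d)) : ℝ :=
  (if c.1 then p else 1 - p) / (Nat.factorial d : ℝ)

def bmJ (d : ℕ) (f : Prop) (c : Bool × Equiv.Perm (Fin d)) : Matrix (Fin d) (Fin d) ℝ :=
  if f then (if c.1 then 1 else permMat d c.2) else (if c.1 then 1 else permMat d c.2)ᵀ

theorem cwJ_nonneg (d : ℕ) (p : ℝ) (h0 : 0 ≤ p) (h1 : p ≤ 1) (c) : 0 ≤ cwJ d p c := by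
  unfold cwJ
  apply div_nonneg _ (by positivity)
  split_ifs <;> linarith

theorem cwJ_sum (d : ℕ) (p : ℝ) : ∑ c, cwJ d p c = 1 := by
  have : (Nat.factorial d : ℝ) ≠ 0 := by positivity
  simp only [cwJ]
  rw [Fintype.sum_prod_type]
  simp [Fintype.card_perm]
  field_simp
  ring

theorem perm_count (d : ℕ) (hd : 0 < d) (t q : Fin d) :
    ∑ σ : Equiv.Perm (Fin d), (if σ q = t then (1 : ℝ) else 0) = (Nat.factorial d : ℝ) / d := by
  have hs : ∀ t' : Fin d, ∑ σ : Equiv.Perm (Fin d), (if σ q = t' then (1 : ℝ) else 0)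
      = ∑ σ : Equiv.Perm (Fin d), (if σ q = t then (1 : ℝ) else 0) := by
    intro t'
    rw [← Equiv.sum_comp (Equiv.mulLeft (Equiv.swap t t'))]
    refine Finset.sum_congr rfl fun σ _ => ?_
    congr 1
    simp [Equiv.swap_apply_eq_iff]
  have h1 : ∑ t' : Fin d, ∑ σ : Equiv.Perm (Fin d), (if σ q = t' then (1 : ℝ) else 0)
      = Nat.factorial d := by
    rw [Finset.sum_comm]
    simp [Fintype.card_perm]
  simp only [hs] at h1
  simp only [Finset.sum_const, Finset.card_univ, Fintype.card_fin, nsmul_eq_mul] at h1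
  have : (d : ℝ) ≠ 0 := by positivity
  field_simp
  simp only [Finset.sum_boole] at h1 ⊢
  linarith

theorem bmJ_exp (d : ℕ) (hd : 0 < d) (p : ℝ) (f : Prop) (t q : Fin d) :
    ∑ c, cwJ d p c * bmJ d f c t q = (if t = q then p else 0) + (1 - p) / d := by
  have hf : (Nat.factorial d : ℝ) ≠ 0 := by positivity
  have hd' : (d : ℝ) ≠ 0 := by positivity
  rw [Fintype.sum_prod_type]
  by_cases h : f
  · simp only [cwJ, bmJ, h, Fintype.sum_bool, permMat, Matrix.of_apply, Matrix.one_apply]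
    simp only [if_true, ← Finset.mul_sum, perm_count d hd, Bool.false_eq_true, if_false, Matrix.of_apply, Matrix.one_apply]
    simp [Fintype.card_perm]
    split_ifs <;> field_simp
  · simp only [cwJ, bmJ, h, Fintype.sum_bool, permMat, Matrix.of_apply, Matrix.one_apply]
    simp only [if_true, ← Finset.mul_sum, perm_count d hd, Bool.false_eq_true, if_false, Matrix.of_apply, Matrix.one_apply, Matrix.transpose_apply]
    simp [Fintype.card_perm, eq_comm]
    split_ifs <;> field_simp

theorem bmJ_zo (d : ℕ) (f : Prop) (c) (t q : Fin d) : bmJ d f c t q = 0 ∨ bmJ d f c t q = 1 := by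
  unfold bmJ permMat
  split_ifs <;> simp [Matrix.one_apply, Matrix.transpose_apply] <;> tauto

theorem bmJ_col (d : ℕ) (f : Prop) (c) (q : Fin d) : ∑ t, bmJ d f c t q = 1 := by
  have h : ∀ x, (c.2 x = q) ↔ (x = c.2.symm q) := fun x => by rw [Equiv.eq_symm_apply]
  unfold bmJ permMat
  split_ifs
  · simp [Matrix.one_apply]
  · simp
  · simp [Matrix.one_apply]
  · simp [h]

theorem bmJ_tr (d : ℕ) (f : Prop) (c) (t q : Fin d) : bmJ d (¬ f) c t q = bmJ d f c q t := by
  unfold bmJ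
  by_cases h : f <;> simp [h]

end aux

section aux2
set_option linter.unusedSimpArgs false

def KJ (d : ℕ) (A B : ℝ) (r : Fin d) (X Y : Matrix (Fin d) (Fin d) ℝ) : ℝ :=
  1 - 2 * A + (A - B * (d - 1) / d) * (X r r + Y r r) + 2 * (B * (d - 1) / d) * (X r r * Y r r)
    + 2 * A * ∑ l ∈ Finset.univ.filter (fun l : Fin d => l ≠ r), X l r * Y l r

def DJ (d : ℕ) (A B : ℝ) (t q : Fin d) (X Y : Matrix (Fin d) (Fin d) ℝ) : ℝ :=
  - (X t t * (A * Y t q + B / d * (1 - Y t t))) - Y q q * (A * X q t + B / d * (1 - X q q))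

def GoodM (d : ℕ) (X : Matrix (Fin d) (Fin d) ℝ) : Prop :=
  (∀ t q, X t q = 0 ∨ X t q = 1) ∧ ∀ q, ∑ t, X t q = 1

theorem GoodM.nn {d : ℕ} {X : Matrix (Fin d) (Fin d) ℝ} (h : GoodM d X) (t q) : 0 ≤ X t q := by
  rcases h.1 t q with h | h <;> simp [h]

theorem GoodM.le {d : ℕ} {X : Matrix (Fin d) (Fin d) ℝ} (h : GoodM d X) (t q) : X t q ≤ 1 := by
  rcases h.1 t q with h | h <;> simp [h]

theorem GoodM.off {d : ℕ} {X : Matrix (Fin d) (Fin d) ℝ} (h : GoodM d X) (r) :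
    ∑ l ∈ Finset.univ.filter (fun l : Fin d => l ≠ r), X l r = 1 - X r r := by
  have := h.2 r
  rw [← Finset.add_sum_erase _ _ (Finset.mem_univ r)] at this
  have h2 : Finset.univ.filter (fun l : Fin d => l ≠ r) = Finset.univ.erase r := by
    ext; simp
  rw [h2]; linarith

theorem card_off (d : ℕ) (r : Fin d) :
    ((Finset.univ.filter (fun l : Fin d => l ≠ r)).card : ℝ) = d - 1 := by
  have h2 : Finset.univ.filter (fun l : Fin d => l ≠ r) = Finset.univ.erase r := by
    ext; simp
  have h3 : 1 ≤ d := by have := r.2; omega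
  rw [h2, Finset.card_erase_of_mem (Finset.mem_univ _)]
  simp [h3]

theorem m_bounds (d : ℕ) (hd : 2 ≤ d) (A B : ℝ) (hB : 0 < B) (hBA : B ≤ A) :
    0 ≤ B * (d - 1) / d ∧ B * (d - 1) / d ≤ A ∧ 0 ≤ B / d ∧ B / d ≤ A := by
  have h2 : (2 : ℝ) ≤ d := by exact_mod_cast hd
  refine ⟨div_nonneg (mul_nonneg hB.le (by linarith)) (by linarith), ?_, by positivity, ?_⟩
  · rw [div_le_iff₀ (by linarith)]; nlinarith
  · rw [div_le_iff₀ (by linarith)]; nlinarith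

theorem Z_bound (d : ℕ) (hd : 2 ≤ d) (A B : ℝ) (hB : 0 < B) (hBA : B ≤ A) (r t q : Fin d)
    (X Y : Matrix (Fin d) (Fin d) ℝ) (hX : GoodM d X) (hY : GoodM d Y) :
    |KJ d A B r X Y + DJ d A B t q X Y| ≤ 1 + 6 * A := by
  obtain ⟨m0, m1, b0, b1⟩ := m_bounds d hd A B hB hBA
  unfold KJ DJ
  set m := B * (d - 1) / d
  set b := B / (d : ℝ)
  have hA : 0 < A := by linarith
  have s0 : 0 ≤ ∑ l ∈ Finset.univ.filter (fun l : Fin d => l ≠ r), X l r * Y l r :=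
    Finset.sum_nonneg fun l _ => mul_nonneg (hX.nn _ _) (hY.nn _ _)
  have s1 : ∑ l ∈ Finset.univ.filter (fun l : Fin d => l ≠ r), X l r * Y l r ≤ 1 := by
    calc _ ≤ ∑ l ∈ Finset.univ.filter (fun l : Fin d => l ≠ r), X l r :=
          Finset.sum_le_sum fun l _ => mul_le_of_le_one_right (hX.nn _ _) (hY.le _ _)
      _ = 1 - X r r := hX.off r
      _ ≤ 1 := by linarith [hX.nn r r]
  set S := ∑ l ∈ Finset.univ.filter (fun l : Fin d => l ≠ r), X l r * Y l r
  have e1 : 0 ≤ 2 * A * S := by positivity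
  have e2 : 2 * A * S ≤ 2 * A := by nlinarith
  rw [abs_le]
  have g : ∀ u v v' : ℝ, 0 ≤ u → u ≤ 1 → 0 ≤ v → v ≤ 1 → 0 ≤ v' → v' ≤ 1 →
      0 ≤ u * (A * v + b * (1 - v')) ∧ u * (A * v + b * (1 - v')) ≤ 2 * A := by
    intro u v v' u0 u1 v0 v1 w0 w1
    have k1 : 0 ≤ A * v := by positivity
    have k2 : A * v ≤ A := mul_le_of_le_one_right hA.le v1
    have k3 : 0 ≤ b * (1 - v') := mul_nonneg b0 (by linarith)
    have k4 : b * (1 - v') ≤ b := mul_le_of_le_one_right b0 (by linarith)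
    refine ⟨mul_nonneg u0 (by linarith), ?_⟩
    exact (mul_le_of_le_one_left (by linarith) u1).trans (by linarith)
  have g1 := g _ _ _ (hX.nn t t) (hX.le t t) (hY.nn t q) (hY.le t q) (hY.nn t t) (hY.le t t)
  have g2 := g _ _ _ (hY.nn q q) (hY.le q q) (hX.nn q t) (hX.le q t) (hX.nn q q) (hX.le q q)
  rcases hX.1 r r with h1 | h1 <;> rcases hY.1 r r with h2 | h2 <;>
  rw [h1, h2] <;> constructor <;> linarith

theorem ex2_mul {Ω : Type} [Fintype Ω] (w f g : Ω → ℝ) :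
    ∑ x, ∑ y, w x * w y * (f x * g y) = (∑ x, w x * f x) * ∑ y, w y * g y := by
  rw [Finset.sum_mul_sum]
  refine Finset.sum_congr rfl fun x _ => Finset.sum_congr rfl fun y _ => by ring

theorem ex2_left {Ω : Type} [Fintype Ω] (w f : Ω → ℝ) (hw : ∑ x, w x = 1) :
    ∑ x, ∑ y, w x * w y * f x = ∑ x, w x * f x := by
  have := ex2_mul w f (fun _ => 1)
  simpa [hw] using this

theorem ex2_right {Ω : Type} [Fintype Ω] (w g : Ω → ℝ) (hw : ∑ x, w x = 1) :
    ∑ x, ∑ y, w x * w y * g y = ∑ x, w x * g x := by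
  have := ex2_mul w (fun _ => 1) g
  simpa [hw] using this

theorem Z_exp (d : ℕ) (hd : 2 ≤ d) (A B p : ℝ) (r t q : Fin d) (htq : t ≠ q) (f g : Prop) :
    ∑ x, ∑ y, cwJ d p x * cwJ d p y *
      (KJ d A B r (bmJ d f x) (bmJ d g y) + DJ d A B t q (bmJ d f x) (bmJ d g y))
    = 1 - 2 * A + (A - B * (d - 1) / d) * (2 * (p + (1 - p) / d))
      + 2 * (B * (d - 1) / d) * (p + (1 - p) / d) ^ 2
      + 2 * A * (d - 1) * ((1 - p) / d) ^ 2
      - 2 * ((p + (1 - p) / d) * (A * ((1 - p) / d) + B / d * (1 - (p + (1 - p) / d)))) := by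
  have hd0 : 0 < d := by omega
  have hw := cwJ_sum d p
  set w := cwJ d p with hwdef
  set m := B * (d - 1) / d
  set b := B / (d : ℝ)
  have expand : ∀ x y, w x * w y *
      (KJ d A B r (bmJ d f x) (bmJ d g y) + DJ d A B t q (bmJ d f x) (bmJ d g y))
     = (1 - 2 * A) * (w x * w y) + (A - m) * (w x * w y * bmJ d f x r r)
      + (A - m) * (w x * w y * bmJ d g y r r)
      + 2 * m * (w x * w y * (bmJ d f x r r * bmJ d g y r r))
      + 2 * A * ∑ l ∈ Finset.univ.filter (fun l : Fin d => l ≠ r),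
          (w x * w y * (bmJ d f x l r * bmJ d g y l r))
      - A * (w x * w y * (bmJ d f x t t * bmJ d g y t q))
      - b * (w x * w y * bmJ d f x t t)
      + b * (w x * w y * (bmJ d f x t t * bmJ d g y t t))
      - A * (w x * w y * (bmJ d f x q t * bmJ d g y q q))
      - b * (w x * w y * bmJ d g y q q)
      + b * (w x * w y * (bmJ d f x q q * bmJ d g y q q)) := by
    intro x y
    rw [← Finset.mul_sum]
    unfold KJ DJ
    ring
  have toP : ∀ h : (Bool × Equiv.Perm (Fin d)) → (Bool × Equiv.Perm (Fin d)) → ℝ,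
      ∑ x, ∑ y, h x y = ∑ z : (Bool × Equiv.Perm (Fin d)) × (Bool × Equiv.Perm (Fin d)),
        h z.1 z.2 := fun h => (Fintype.sum_prod_type' h).symm
  have H1 : ∀ t q : Fin d, ∑ z : (Bool × Equiv.Perm (Fin d)) × (Bool × Equiv.Perm (Fin d)),
      w z.1 * w z.2 * bmJ d f z.1 t q
      = (if t = q then p else 0) + (1 - p) / d := fun t q => by
    rw [← toP (fun x y => w x * w y * bmJ d f x t q), ex2_left w (fun x => bmJ d f x t q) hw,
      bmJ_exp d hd0]
  have H2 : ∀ t q : Fin d, ∑ z : (Bool × Equiv.Perm (Fin d)) × (Bool × Equiv.Perm (Fin d)),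
      w z.1 * w z.2 * bmJ d g z.2 t q
      = (if t = q then p else 0) + (1 - p) / d := fun t q => by
    rw [← toP (fun x y => w x * w y * bmJ d g y t q), ex2_right w (fun x => bmJ d g x t q) hw,
      bmJ_exp d hd0]
  have H3 : ∀ t q t' q' : Fin d,
      ∑ z : (Bool × Equiv.Perm (Fin d)) × (Bool × Equiv.Perm (Fin d)),
      w z.1 * w z.2 * (bmJ d f z.1 t q * bmJ d g z.2 t' q')
      = ((if t = q then p else 0) + (1 - p) / d) * ((if t' = q' then p else 0) + (1 - p) / d) :=
    fun t q t' q' => by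
    rw [← toP (fun x y => w x * w y * (bmJ d f x t q * bmJ d g y t' q')),
      ex2_mul w (fun x => bmJ d f x t q) (fun y => bmJ d g y t' q'), bmJ_exp d hd0, bmJ_exp d hd0]
  have hsw : ∑ z : (Bool × Equiv.Perm (Fin d)) × (Bool × Equiv.Perm (Fin d)),
      ∑ l ∈ Finset.univ.filter (fun l : Fin d => l ≠ r),
          (w z.1 * w z.2 * (bmJ d f z.1 l r * bmJ d g z.2 l r)) = (d - 1) * ((1 - p) / d) ^ 2 := by
    rw [Finset.sum_comm]
    rw [← card_off d r, ← nsmul_eq_mul, ← Finset.sum_const]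
    refine Finset.sum_congr rfl fun l hl => ?_
    have hl : l ≠ r := by simpa using hl
    rw [H3]
    simp [hl]; ring
  have hww : ∑ z : (Bool × Equiv.Perm (Fin d)) × (Bool × Equiv.Perm (Fin d)),
      w z.1 * w z.2 = 1 := by
    rw [← toP (fun x y => w x * w y), ← Finset.sum_mul_sum, hw, one_mul]
  simp only [expand]
  rw [toP]
  simp only [Finset.sum_add_distrib, Finset.sum_sub_distrib, ← Finset.mul_sum _ _ (2 * A),
    ← Finset.mul_sum _ _ A, ← Finset.mul_sum _ _ b, ← Finset.mul_sum _ _ (2 * m),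
    ← Finset.mul_sum _ _ (A - m), ← Finset.mul_sum _ _ (1 - 2 * A), H1, H2, H3, hsw, hww]
  simp only [if_true, htq, htq.symm, if_false]
  ring

theorem E_lower (d : ℝ) (hd : 2 ≤ d) (A B p : ℝ) (hp0 : 0 ≤ p) (hp1 : p ≤ 1) (hB : 0 < B)
    (hBA : B ≤ A) :
    2 * (1 / 2 - A * (1 - p) - B * p * (1 - p)) ≤
     1 - 2 * A + (A - B * (d - 1) / d) * (2 * (p + (1 - p) / d))
      + 2 * (B * (d - 1) / d) * (p + (1 - p) / d) ^ 2
      + 2 * A * (d - 1) * ((1 - p) / d) ^ 2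
      - 2 * ((p + (1 - p) / d) * (A * ((1 - p) / d) + B / d * (1 - (p + (1 - p) / d)))) := by
  have key : 1 - 2 * A + (A - B * (d - 1) / d) * (2 * (p + (1 - p) / d))
      + 2 * (B * (d - 1) / d) * (p + (1 - p) / d) ^ 2
      + 2 * A * (d - 1) * ((1 - p) / d) ^ 2
      - 2 * ((p + (1 - p) / d) * (A * ((1 - p) / d) + B / d * (1 - (p + (1 - p) / d))))
      = 2 * (1 / 2 - A * (1 - p) - B * p * (1 - p)) +
        2 * (1 - p) / d * ((2 * A - B) * ((1 - p) * (1 - 1 / d)) + B * p) := by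
    field_simp
    ring
  rw [key]
  have h1 : 1 / d ≤ 1 := by rw [div_le_one (by linarith)]; linarith
  have h2 : 0 ≤ (2 * A - B) * ((1 - p) * (1 - 1 / d)) :=
    mul_nonneg (by linarith) (mul_nonneg (by linarith) (by linarith))
  have h3 : 0 ≤ B * p := by positivity
  have h4 : 0 ≤ 2 * (1 - p) / d := div_nonneg (by linarith) (by linarith)
  have := mul_nonneg h4 (add_nonneg h2 h3)
  linarith

end aux2

section aux3
set_option linter.unusedSimpArgs false

theorem sum_off2 (n : ℕ) (i j : Fin n) (hij : i ≠ j) (f : Fin n → ℝ) :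
    ∑ k ∈ Finset.univ.filter (fun k : Fin n => k ≠ i), f k =
      f j + ∑ k ∈ Finset.univ.filter (fun k : Fin n => k ≠ i ∧ k ≠ j), f k := by
  have : Finset.univ.filter (fun k : Fin n => k ≠ i) =
      insert j (Finset.univ.filter (fun k : Fin n => k ≠ i ∧ k ≠ j)) := by
    ext k; simp only [Finset.mem_filter, Finset.mem_univ, true_and, Finset.mem_insert]
    constructor
    · intro h; by_cases hk : k = j <;> simp [hk, h]
    · rintro (h | h)
      · rw [h]; exact hij.symm
      · exact h.1
  rw [this, Finset.sum_insert (by simp)]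

theorem card_off2 (n : ℕ) (i j : Fin n) (hij : i ≠ j) :
    ((Finset.univ.filter (fun k : Fin n => k ≠ i ∧ k ≠ j)).card : ℝ) + 2 = n := by
  have h1 := sum_off2 n i j hij (fun _ => 1)
  have h2 := card_off n i
  simp only [Finset.sum_const, nsmul_eq_mul, mul_one] at h1
  linarith

theorem min_sum_lower (d : ℕ) (hd : 2 ≤ d) (A B : ℝ) (hB : 0 < B) (hBA : B ≤ A) (t : Fin d)
    (X Y : Matrix (Fin d) (Fin d) ℝ) (hX : GoodM d X) (hY : GoodM d Y) :
    KJ d A B t X Y - 1 + ((d : ℝ) - 2) * A - (A - B * (d - 1) / d) * (1 - X t t - Y t t) ≤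
    ∑ l ∈ Finset.univ.filter (fun l : Fin d => l ≠ t),
      min ((1 - 2 * X l t) * A + (1 - 2 * Y t t) * (B / d))
        ((1 - 2 * Y l t) * A + (1 - 2 * X t t) * (B / d)) := by
  obtain ⟨m0, m1, b0, b1⟩ := m_bounds d hd A B hB hBA
  have hd0 : (d : ℝ) ≠ 0 := by positivity
  have hA : 0 < A := by linarith
  have h1 : ∀ l, (A + B / d - 2 * (B / d) * (X t t + Y t t - X t t * Y t t))
      - 2 * A * X l t - 2 * A * Y l t + 2 * A * (X l t * Y l t) ≤
      min ((1 - 2 * X l t) * A + (1 - 2 * Y t t) * (B / d))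
        ((1 - 2 * Y l t) * A + (1 - 2 * X t t) * (B / d)) := by
    intro l
    refine le_min ?_ ?_
    · have e1 := mul_nonneg (mul_nonneg hA.le (hY.nn l t)) (sub_nonneg.2 (hX.le l t))
      have e2 := mul_nonneg (mul_nonneg b0 (hX.nn t t)) (sub_nonneg.2 (hY.le t t))
      nlinarith
    · have e1 := mul_nonneg (mul_nonneg hA.le (hX.nn l t)) (sub_nonneg.2 (hY.le l t))
      have e2 := mul_nonneg (mul_nonneg b0 (hY.nn t t)) (sub_nonneg.2 (hX.le t t))
      nlinarith
  refine le_trans (le_of_eq ?_) (Finset.sum_le_sum fun l _ => h1 l)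
  simp only [Finset.sum_add_distrib, Finset.sum_sub_distrib, ← Finset.mul_sum, hX.off, hY.off,
    Finset.sum_const, nsmul_eq_mul, card_off]
  unfold KJ
  field_simp
  ring

theorem kappa_lower (n d : ℕ) (hd : 2 ≤ d) (a X : Fin n → Fin n → Matrix (Fin d) (Fin d) ℝ)
    (ha : ∀ i j t q, a i j t q = 1 - 2 * X i j t q) (hX : ∀ i j, GoodM d (X i j))
    (α β : ℝ) (hα : 0 < α) (hαβ : α ≤ β) (i j : Fin n) (hij : i ≠ j) (t : Fin d)
    (h1 : X i j t t = 1) (h2 : X j i t t = 1) :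
    (1 / (n : ℝ)) * (∑ k ∈ Finset.univ.filter (fun k : Fin n => k ≠ i ∧ k ≠ j),
        KJ d (1 / α) (1 / β) t (X k i) (X k j) - 5 * d * (1 / α)) ≤ kappaJOM n d a α β i j t := by
  have hβ : 0 < β := by linarith
  have hB : 0 < 1 / β := by positivity
  have hBA : 1 / β ≤ 1 / α := one_div_le_one_div_of_le hα hαβ
  have hn : (0 : ℝ) < n := by
    have : 0 < n := by have := i.2; omega
    exact_mod_cast this
  have hd2 : (2 : ℝ) ≤ d := by exact_mod_cast hd
  have hd0 : (d : ℝ) ≠ 0 := by positivity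
  set A := 1 / α with hAdef
  set B := 1 / β with hBdef
  obtain ⟨m0, m1, b0, b1⟩ := m_bounds d hd A B hB hBA
  have hA : 0 < A := by linarith
  have hcard := card_off2 n i j hij
  have hS1 : ∑ k ∈ Finset.univ.filter (fun k : Fin n => k ≠ i ∧ k ≠ j),
      (KJ d A B t (X k i) (X k j) - 1 + ((d : ℝ) - 2) * A
        - (A - B * (d - 1) / d) * (1 - X k i t t - X k j t t)) ≤
      ∑ l ∈ Finset.univ.filter (fun l : Fin d => l ≠ t),
        ∑ k ∈ Finset.univ.filter (fun k : Fin n => k ≠ i ∧ k ≠ j),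
          min (a k i l t / α + a k j t t / (β * d)) (a k j l t / α + a k i t t / (β * d)) := by
    rw [Finset.sum_comm]
    refine Finset.sum_le_sum fun k _ => ?_
    refine (min_sum_lower d hd A B hB hBA t (X k i) (X k j) (hX _ _) (hX _ _)).trans (le_of_eq ?_)
    refine Finset.sum_congr rfl fun l _ => ?_
    simp only [ha, hAdef, hBdef]
    congr 1 <;> field_simp
  have hS4 : -(2 * (d - 1) * (2 * A)) ≤ ∑ l ∈ Finset.univ.filter (fun l : Fin d => l ≠ t),
          ((a i j t l + a j i t l) / α + 2 * a i j t t / (β * d)) := by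
    have : ∀ l, -(2 * (2 * A)) ≤ (a i j t l + a j i t l) / α + 2 * a i j t t / (β * d) := by
      intro l
      have e : (a i j t l + a j i t l) / α + 2 * a i j t t / (β * d)
        = (a i j t l + a j i t l) * A + 2 * a i j t t * (B / d) := by
        rw [hAdef, hBdef]; field_simp
      rw [e]
      simp only [ha, h1]
      have e1 := mul_nonneg (sub_nonneg.2 ((hX i j).le t l)) hA.le
      have e2 := mul_nonneg (sub_nonneg.2 ((hX j i).le t l)) hA.le
      nlinarith
    have h := Finset.sum_le_sum (s := Finset.univ.filter (fun l : Fin d => l ≠ t)) fun l _ => this l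
    rw [Finset.sum_const, nsmul_eq_mul, card_off] at h
    linarith
  have hS2 : (∑ k ∈ Finset.univ.filter (fun k : Fin n => k ≠ i), a k i t t) +
          ∑ k ∈ Finset.univ.filter (fun k : Fin n => k ≠ j), a k j t t =
          -2 + 2 * ∑ k ∈ Finset.univ.filter (fun k : Fin n => k ≠ i ∧ k ≠ j),
            (1 - X k i t t - X k j t t) := by
    rw [sum_off2 n i j hij, sum_off2 n j i hij.symm]
    have : Finset.univ.filter (fun k : Fin n => k ≠ j ∧ k ≠ i) =
      Finset.univ.filter (fun k : Fin n => k ≠ i ∧ k ≠ j) := by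
      ext; simp [and_comm]
    rw [this]
    simp only [ha, h1, h2]
    rw [Finset.mul_sum]
    have h3 : ∀ k, 2 * (1 - X k i t t - X k j t t) = (1 - 2 * X k i t t) + (1 - 2 * X k j t t) := by
      intro k; ring
    simp only [h3]
    rw [Finset.sum_add_distrib (f := fun k => 1 - 2 * X k i t t)]
    ring
  unfold kappaJOM
  rw [hS2]
  set S1 := ∑ l ∈ Finset.univ.filter (fun l : Fin d => l ≠ t),
        ∑ k ∈ Finset.univ.filter (fun k : Fin n => k ≠ i ∧ k ≠ j),
          min (a k i l t / α + a k j t t / (β * d)) (a k j l t / α + a k i t t / (β * d))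
  set S4 := ∑ l ∈ Finset.univ.filter (fun l : Fin d => l ≠ t),
          ((a i j t l + a j i t l) / α + 2 * a i j t t / (β * d))
  rw [Finset.sum_sub_distrib, Finset.sum_add_distrib, Finset.sum_sub_distrib,
    ← Finset.mul_sum _ _ (A - B * (d - 1) / d)] at hS1
  simp only [Finset.sum_const, nsmul_eq_mul, mul_one] at hS1
  set S3 := ∑ k ∈ Finset.univ.filter (fun k : Fin n => k ≠ i ∧ k ≠ j),
            (1 - X k i t t - X k j t t)
  set SK := ∑ k ∈ Finset.univ.filter (fun k : Fin n => k ≠ i ∧ k ≠ j),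
        KJ d A B t (X k i) (X k j)
  set c : ℝ := ((Finset.univ.filter (fun k : Fin n => k ≠ i ∧ k ≠ j)).card : ℝ)
  set m := B * (d - 1) / d with hm
  have hc : 1 / (2 * α) - ((d : ℝ) - 1) / (2 * β * d) = (A - m) / 2 := by
    rw [hm, hAdef, hBdef]; field_simp
  have hq : ((d : ℝ) - 2) / α = (d - 2) * A := by rw [hAdef]; ring
  rw [hc, hq]
  have hfin : 1 / (n : ℝ) * S1 + 1 / (n : ℝ) * ((A - m) / 2) * (-2 + 2 * S3) - (d - 2) * A + 1
      + 1 / (2 * (n : ℝ)) * S4 = 1 / (n : ℝ) * (S1 + (A - m) * (S3 - 1) + (c + 2) * (1 - (d - 2) * A)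
        + S4 / 2) := by
    rw [hcard]; field_simp; ring
  rw [hfin]
  refine mul_le_mul_of_nonneg_left ?_ (by positivity)
  nlinarith

theorem delta_eq (n d : ℕ) (hd : 2 ≤ d) (a X : Fin n → Fin n → Matrix (Fin d) (Fin d) ℝ)
    (ha : ∀ i j t q, a i j t q = 1 - 2 * X i j t q) (hX : ∀ i j, GoodM d (X i j))
    (α β : ℝ) (hα : 0 < α) (hαβ : α ≤ β) (i j : Fin n) (t q : Fin d)
    (h1 : X i j t t = 1) (h2 : X j i q q = 1) (h3 : X i j t q = 0) (h4 : X j i q t = 0) :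
    (deltaJOM n d a α β i j t q + deltaJOM n d a α β j i q t) / 2 =
    (1 / (n : ℝ)) * ∑ k ∈ Finset.univ.filter (fun k : Fin n => k ≠ i ∧ k ≠ j),
        DJ d (1 / α) (1 / β) t q (X k i) (X k j) := by
  have hβ : 0 < β := by linarith
  have hd0 : (d : ℝ) ≠ 0 := by positivity
  have g : ∀ (i j : Fin n) (t q : Fin d), X i j t t = 1 → X i j t q = 0 →
      deltaJOM n d a α β i j t q = (1 / (n : ℝ)) *
      ∑ k ∈ Finset.univ.filter (fun k : Fin n => k ≠ i ∧ k ≠ j),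
        (-2) * (X k i t t * (1 / α * X k j t q + 1 / β / d * (1 - X k j t t))) := by
    intro i j t q h1 h3
    unfold deltaJOM
    congr 1
    have : Finset.univ.filter (fun k : Fin n => k ≠ i ∧ k ≠ j ∧ a k i t t = -1) =
      (Finset.univ.filter (fun k : Fin n => k ≠ i ∧ k ≠ j)).filter (fun k => a k i t t = -1) := by
      ext; simp [and_assoc]
    rw [this, Finset.sum_filter]
    refine Finset.sum_congr rfl fun k _ => ?_
    simp only [ha, h1, h3]
    rcases (hX k i).1 t t with h | h
    · rw [h]; norm_num
    · rw [h]; norm_num; field_simp; ring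
  rw [g i j t q h1 h3, g j i q t h2 h4]
  have : Finset.univ.filter (fun k : Fin n => k ≠ j ∧ k ≠ i) =
      Finset.univ.filter (fun k : Fin n => k ≠ i ∧ k ≠ j) := by
      ext; simp [and_comm]
  rw [this, ← mul_add, ← Finset.sum_add_distrib, mul_div_assoc, Finset.sum_div]
  congr 1
  refine Finset.sum_congr rfl fun k _ => ?_
  unfold DJ
  ring

end aux3

section aux4
set_option linter.unusedSimpArgs false

theorem Xin_eq (n d : ℕ) (ω : Sample n d) (k i : Fin n) (h : k ≠ i) :
    XinRand n d ω k i = bmJ d (k < i) (ω (min k i) (max k i)) := by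
  unfold XinRand baseMat bmJ
  rcases lt_or_gt_of_ne h with h | h
  · simp [h, min_eq_left h.le, max_eq_right h.le]
  · simp [h, not_lt.2 h.le, min_eq_right h.le, max_eq_left h.le]

theorem Xin_good (n d : ℕ) (ω : Sample n d) (k i : Fin n) : GoodM d (XinRand n d ω k i) := by
  by_cases h : k = i
  · subst h
    have : XinRand n d ω k k = 1 := by simp [XinRand]
    rw [this]
    refine ⟨fun t q => ?_, fun q => by simp [Matrix.one_apply]⟩
    simp only [Matrix.one_apply]; split_ifs <;> simp
  · rw [Xin_eq n d ω k i h]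
    exact ⟨bmJ_zo _ _ _, bmJ_col _ _ _⟩

theorem Xin_symm (n d : ℕ) (ω : Sample n d) (i j : Fin n) (h : i < j) (t q : Fin d) :
    XinRand n d ω j i t q = XinRand n d ω i j q t := by
  simp [XinRand, h, not_lt.2 h.le]

theorem wt_eq (n d : ℕ) (p : ℝ) (ω : Fin n × Fin n → Bool × Equiv.Perm (Fin d)) :
    wtJOM n d p (Function.curry ω) = ∏ z, cwJ d p (ω z) := by
  rw [Fintype.prod_prod_type]; rfl

theorem wt_nonneg (n d : ℕ) (p : ℝ) (h0 : 0 ≤ p) (h1 : p ≤ 1) (ω : Sample n d) :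
    0 ≤ wtJOM n d p ω :=
  Finset.prod_nonneg fun i _ => Finset.prod_nonneg fun j _ => cwJ_nonneg d p h0 h1 (ω i j)

theorem wt_sum (n d : ℕ) (p : ℝ) : ∑ ω : Sample n d, wtJOM n d p ω = 1 := by
  rw [← Equiv.sum_comp (Equiv.curry (Fin n) (Fin n) (Bool × Equiv.Perm (Fin d)))]
  have := aux_factor (ι := Fin n × Fin n) (κ := Empty) (cwJ d p) (cwJ_sum d p) (fun z => z.1.elim)
    (fun z => z.1.elim) (fun k _ _ => 0)
  simp only [Finset.univ_eq_empty, Finset.prod_empty, mul_one] at this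
  rw [← this]
  exact Finset.sum_congr rfl fun ω _ => wt_eq n d p ω

def eJ (n : ℕ) (i j : Fin n) (z : {k : Fin n // k ≠ i ∧ k ≠ j} × Bool) : Fin n × Fin n :=
  if z.2 then (min z.1.1 i, max z.1.1 i) else (min z.1.1 j, max z.1.1 j)

theorem eJ_inj (n : ℕ) (i j : Fin n) (hij : i ≠ j) : Function.Injective (eJ n i j) := by
  rintro ⟨⟨k, hk⟩, b⟩ ⟨⟨k', hk'⟩, b'⟩ h
  have hA : ∀ x y x' y' : Fin n, x ≠ y → (min x y, max x y) = (min x' y', max x' y') →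
      (x = x' ∧ y = y') ∨ (x = y' ∧ y = x') := by
    intro x y x' y' hxy h
    rw [Prod.mk.injEq] at h
    obtain ⟨h1, h2⟩ := h
    rcases le_total x y with a | a <;> rcases le_total x' y' with a' | a' <;>
      simp only [min_eq_left, min_eq_right, max_eq_left, max_eq_right, a, a'] at h1 h2 <;> tauto
  cases b <;> cases b' <;> simp only [eJ, if_true, if_false, Bool.false_eq_true] at h
  · rcases hA _ _ _ _ hk.2 h with ⟨h1, h2⟩ | ⟨h1, h2⟩
    · subst h1; rfl
    · exact absurd h1 hk.2
  · rcases hA _ _ _ _ hk.2 h with ⟨h1, h2⟩ | ⟨h1, h2⟩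
    · exact absurd h2.symm hij
    · exact absurd h1 hk.1
  · rcases hA _ _ _ _ hk.1 h with ⟨h1, h2⟩ | ⟨h1, h2⟩
    · exact absurd h2 hij
    · exact absurd h1 hk.2
  · rcases hA _ _ _ _ hk.1 h with ⟨h1, h2⟩ | ⟨h1, h2⟩
    · subst h1; rfl
    · exact absurd h1 hk.1

def badJ (n d : ℕ) (A B μ : ℝ) (i j : Fin n) (r t q : Fin d) (ω : Sample n d) : Prop :=
  i ≠ j ∧ t ≠ q ∧ ∑ k ∈ Finset.univ.filter (fun k : Fin n => k ≠ i ∧ k ≠ j),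
      (KJ d A B r (XinRand n d ω k i) (XinRand n d ω k j)
        + DJ d A B t q (XinRand n d ω k i) (XinRand n d ω k j)) ≤ ((n : ℝ) - 2) * (μ / 2)

theorem bad_prob (n d : ℕ) (hd : 2 ≤ d) (p A B μ : ℝ) (hp0 : 0 ≤ p) (hp1 : p ≤ 1) (hB : 0 < B)
    (hBA : B ≤ A) (hμ : μ = 2 * (1 / 2 - A * (1 - p) - B * p * (1 - p))) (hμ0 : 0 < μ)
    (i j : Fin n) (r t q : Fin d) :
    prJOM n d p (badJ n d A B μ i j r t q) ≤ (1 - μ ^ 2 / (16 * (2 + 6 * A) ^ 2)) ^ (n - 2) := by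
  have hA : 0 < A := by linarith
  have hμ1 : μ ≤ 1 := by
    have : 0 ≤ A * (1 - p) := mul_nonneg hA.le (by linarith)
    have : 0 ≤ B * p * (1 - p) := mul_nonneg (by positivity) (by linarith)
    linarith
  have hρ : 0 ≤ 1 - μ ^ 2 / (16 * (2 + 6 * A) ^ 2) := by
    rw [sub_nonneg, div_le_one (by positivity)]; nlinarith
  by_cases hij : i ≠ j
  swap
  · have : ∀ ω, ¬ badJ n d A B μ i j r t q ω := fun ω h => hij h.1
    simp only [prJOM, this, if_false, Finset.sum_const_zero]
    positivity
  by_cases htq : t ≠ q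
  swap
  · have : ∀ ω, ¬ badJ n d A B μ i j r t q ω := fun ω h => htq h.2.1
    simp only [prJOM, this, if_false, Finset.sum_const_zero]
    positivity
  have hcard : (Fintype.card {k : Fin n // k ≠ i ∧ k ≠ j} : ℝ) = n - 2 := by
    rw [Fintype.card_subtype]
    linarith [card_off2 n i j hij]
  have hcardN : Fintype.card {k : Fin n // k ≠ i ∧ k ≠ j} = n - 2 := by
    have : Fintype.card {k : Fin n // k ≠ i ∧ k ≠ j} + 2 = n := by
      have : (Fintype.card {k : Fin n // k ≠ i ∧ k ≠ j} : ℝ) + 2 = n := by linarith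
      exact_mod_cast this
    omega
  have main := aux_chernoff (κ := {k : Fin n // k ≠ i ∧ k ≠ j}) (cwJ d p) (cwJ_sum d p)
    (cwJ_nonneg d p hp0 hp1) (eJ n i j) (eJ_inj n i j hij)
    (fun k x y => KJ d A B r (bmJ d (k.1 < i) x) (bmJ d (k.1 < j) y)
      + DJ d A B t q (bmJ d (k.1 < i) x) (bmJ d (k.1 < j) y)) (2 + 6 * A) μ hμ0 (by positivity)
    (by linarith)
    (by
      intro k x y
      have := abs_le.1 (Z_bound d hd A B hB hBA r t q (bmJ d (k.1 < i) x) (bmJ d (k.1 < j) y)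
        ⟨bmJ_zo _ _ _, bmJ_col _ _ _⟩ ⟨bmJ_zo _ _ _, bmJ_col _ _ _⟩)
      rw [abs_le]
      constructor <;> linarith)
    (by
      intro k
      rw [Z_exp d hd A B p r t q htq, hμ]
      exact E_lower d (by exact_mod_cast hd) A B p hp0 hp1 hB hBA)
  rw [hcardN] at main
  refine le_trans (le_of_eq ?_) main
  unfold prJOM
  rw [← Equiv.sum_comp (Equiv.curry (Fin n) (Fin n) (Bool × Equiv.Perm (Fin d)))]
  refine Finset.sum_congr rfl fun ω _ => ?_
  have hiff : badJ n d A B μ i j r t q (Function.curry ω) ↔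
      ∑ k : {k : Fin n // k ≠ i ∧ k ≠ j},
       (KJ d A B r (bmJ d (k.1 < i) (ω (eJ n i j (k, true)))) (bmJ d (k.1 < j) (ω (eJ n i j (k, false))))
      + DJ d A B t q (bmJ d (k.1 < i) (ω (eJ n i j (k, true)))) (bmJ d (k.1 < j) (ω (eJ n i j (k, false)))))
       ≤ ((n - 2 : ℕ) : ℝ) * (μ / 2) := by
    unfold badJ
    rw [← hcardN, hcard, Finset.sum_subtype (p := fun k => k ≠ i ∧ k ≠ j)
      (F := inferInstance) _ (by simp)]
    simp only [hij, htq, ne_eq, not_false_eq_true, true_and]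
    have : ∀ k : {k : Fin n // k ≠ i ∧ k ≠ j},
        XinRand n d (Function.curry ω) k.1 i = bmJ d (k.1 < i) (ω (eJ n i j (k, true))) ∧
        XinRand n d (Function.curry ω) k.1 j = bmJ d (k.1 < j) (ω (eJ n i j (k, false))) := by
      intro k
      rw [Xin_eq _ _ _ _ _ k.2.1, Xin_eq _ _ _ _ _ k.2.2]
      exact ⟨rfl, rfl⟩
    refine iff_of_eq ?_
    congr 1
    refine Finset.sum_congr rfl fun k _ => ?_
    rw [(this k).1, (this k).2]
  change (if badJ n d A B μ i j r t q (Function.curry ω) then wtJOM n d p (Function.curry ω) else 0) = _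
  rw [wt_eq]
  by_cases hb : badJ n d A B μ i j r t q (Function.curry ω)
  · rw [if_pos hb, if_pos (hiff.1 hb)]
  · rw [if_neg hb, if_neg (fun h => hb (hiff.2 h))]

theorem pr_le_one (n d : ℕ) (p : ℝ) (h0 : 0 ≤ p) (h1 : p ≤ 1) (E : Sample n d → Prop) :
    prJOM n d p E ≤ 1 := by
  rw [← wt_sum n d p]
  refine Finset.sum_le_sum fun ω _ => ?_
  split_ifs
  · exact le_rfl
  · exact wt_nonneg n d p h0 h1 ω

theorem pr_union (n d : ℕ) (p : ℝ) (h0 : 0 ≤ p) (h1 : p ≤ 1) (E : Sample n d → Prop)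
    {J : Type} [Fintype J] (F : J → Sample n d → Prop) (ρ : ℝ) (hF : ∀ z, prJOM n d p (F z) ≤ ρ)
    (h : ∀ ω, (∀ z, ¬ F z ω) → E ω) :
    1 - Fintype.card J * ρ ≤ prJOM n d p E := by
  have h2 : 1 ≤ prJOM n d p E + ∑ z, prJOM n d p (F z) := by
    rw [← wt_sum n d p]
    unfold prJOM
    rw [Finset.sum_comm, ← Finset.sum_add_distrib]
    refine Finset.sum_le_sum fun ω _ => ?_
    have hw := wt_nonneg n d p h0 h1 ω
    have hn : ∀ z ∈ Finset.univ, 0 ≤ if F z ω then wtJOM n d p ω else 0 := by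
      intro z _; split_ifs
      · exact hw
      · exact le_rfl
    by_cases hE : E ω
    · rw [if_pos hE]; linarith [Finset.sum_nonneg hn]
    · have : ∃ z, F z ω := by
        by_contra hc; exact hE (h ω (fun z hz => hc ⟨z, hz⟩))
      obtain ⟨z, hz⟩ := this
      have := Finset.single_le_sum hn (Finset.mem_univ z)
      rw [if_pos hz] at this
      rw [if_neg hE]; linarith
  have h3 : ∑ z, prJOM n d p (F z) ≤ Fintype.card J * ρ := by
    have := Finset.sum_le_sum (s := Finset.univ) fun z _ => hF z
    simpa using this
  linarith

end aux4
/-- Under the random corruption model, if `0 < α ≤ β ≤ 2`,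
`p²/β + (1/α − 1/β)p + (1/2 − 1/α) > 0`, `p ≥ 1/4`, `n² > 12 d(n)` and
`d(n)⁴ log n / n → 0`, then with probability tending to one condition (C3) holds
strictly. -/
theorem C3_strict_whp
    (d : ℕ → ℕ) (hd : ∀ n, 2 ≤ d n)
    (hdo : Filter.Tendsto (fun n : ℕ => (d n : ℝ) ^ 4 * Real.log n / n)
      Filter.atTop (nhds 0))
    (p α β : ℝ) (hp0 : 0 ≤ p) (hp1 : p ≤ 1) (hα : 0 < α) (hαβ : α ≤ β) (hβ2 : β ≤ 2)
    (hA4 : 0 < p ^ 2 / β + (1 / α - 1 / β) * p + (1 / 2 - 1 / α))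
    (hA5 : 1 / 4 ≤ p)
    (hA6 : ∀ᶠ n in Filter.atTop, 12 * d n < n ^ 2) :
    Filter.Tendsto (fun n : ℕ =>
        prJOM n (d n) p (fun ω =>
          ∀ i j : Fin n, i < j → ∀ t q : Fin (d n),
            aRand n (d n) ω i j t t = -1 → aRand n (d n) ω i j q q = -1 →
            aRand n (d n) ω i j t q = 1 →
            (0 < kappaJOM n (d n) (aRand n (d n) ω) α β i j t +
                (deltaJOM n (d n) (aRand n (d n) ω) α β i j t q +
                  deltaJOM n (d n) (aRand n (d n) ω) α β j i q t) / 2) ∧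
            (0 < kappaJOM n (d n) (aRand n (d n) ω) α β i j q +
                (deltaJOM n (d n) (aRand n (d n) ω) α β i j t q +
                  deltaJOM n (d n) (aRand n (d n) ω) α β j i q t) / 2)))
      Filter.atTop (nhds 1) := by
  have hβ : 0 < β := by linarith
  have hB : 0 < 1 / β := by positivity
  have hBA : 1 / β ≤ 1 / α := one_div_le_one_div_of_le hα hαβ
  have hA : 0 < 1 / α := by positivity
  obtain ⟨μ, hμ⟩ : ∃ μ, μ = 2 * (1 / 2 - 1 / α * (1 - p) - 1 / β * p * (1 - p)) := ⟨_, rfl⟩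
  have hμ0 : 0 < μ := by
    rw [hμ]
    have : p ^ 2 / β + (1 / α - 1 / β) * p + (1 / 2 - 1 / α)
      = 1 / 2 - 1 / α * (1 - p) - 1 / β * p * (1 - p) := by ring
    linarith
  obtain ⟨ρ, hρ⟩ : ∃ ρ, ρ = 1 - μ ^ 2 / (16 * (2 + 6 * (1 / α)) ^ 2) := ⟨_, rfl⟩
  have hμ1 : μ ≤ 1 := by
    have : 0 ≤ 1 / α * (1 - p) := mul_nonneg hA.le (by linarith)
    have : 0 ≤ 1 / β * p * (1 - p) := mul_nonneg (by positivity) (by linarith)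
    linarith
  have hρ0 : 0 < ρ := by
    rw [hρ, sub_pos, div_lt_one (by positivity)]; nlinarith
  have hρ1 : ρ < 1 := by
    rw [hρ]
    have : 0 < μ ^ 2 / (16 * (2 + 6 * (1 / α)) ^ 2) := by positivity
    linarith
  -- the ratio d n / n tends to zero
  have hdn : ∀ ε : ℝ, 0 < ε → ∀ᶠ n : ℕ in Filter.atTop, (d n : ℝ) ≤ ε * n := by
    intro ε hε
    have h1 := hdo.eventually (gt_mem_nhds hε)
    have h2 : ∀ᶠ n : ℕ in Filter.atTop, (1 : ℝ) ≤ Real.log n :=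
      (Real.tendsto_log_atTop.comp tendsto_natCast_atTop_atTop).eventually_ge_atTop 1
    filter_upwards [h1, h2, Filter.eventually_gt_atTop 0] with n h1 h2 h3
    have hn : (0 : ℝ) < n := by exact_mod_cast h3
    rw [div_lt_iff₀ hn] at h1
    have hd1 : (1 : ℝ) ≤ d n := by exact_mod_cast (by linarith [hd n] : 1 ≤ d n)
    have h4 : (d n : ℝ) ≤ (d n : ℝ) ^ 4 := le_self_pow₀ hd1 (by norm_num)
    have h5 : (d n : ℝ) ^ 4 ≤ (d n : ℝ) ^ 4 * Real.log n :=
      le_mul_of_one_le_right (by positivity) h2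
    linarith
  have hlim : Filter.Tendsto (fun n : ℕ => 1 - (2 * ρ⁻¹ ^ 2) * ((n : ℝ) ^ 4 * ρ ^ n))
      Filter.atTop (nhds 1) := by
    have := tendsto_pow_const_mul_const_pow_of_abs_lt_one 4 (r := ρ) (by rw [abs_of_pos hρ0]; exact hρ1)
    have := (this.const_mul (2 * ρ⁻¹ ^ 2)).const_sub 1
    simpa using this
  refine tendsto_of_tendsto_of_tendsto_of_le_of_le' hlim tendsto_const_nhds ?_
    (Filter.Eventually.of_forall fun n => pr_le_one n (d n) p hp0 hp1 _)
  have hε : 0 < μ * α / 40 := by positivity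
  filter_upwards [hdn 1 one_pos, hdn _ hε, Filter.eventually_ge_atTop 5] with n hd1 hd2 hn5
  have hn : (5 : ℝ) ≤ n := by exact_mod_cast hn5
  have key := pr_union n (d n) p hp0 hp1 (fun ω =>
          ∀ i j : Fin n, i < j → ∀ t q : Fin (d n),
            aRand n (d n) ω i j t t = -1 → aRand n (d n) ω i j q q = -1 →
            aRand n (d n) ω i j t q = 1 →
            (0 < kappaJOM n (d n) (aRand n (d n) ω) α β i j t +
                (deltaJOM n (d n) (aRand n (d n) ω) α β i j t q +
                  deltaJOM n (d n) (aRand n (d n) ω) α β j i q t) / 2) ∧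
            (0 < kappaJOM n (d n) (aRand n (d n) ω) α β i j q +
                (deltaJOM n (d n) (aRand n (d n) ω) α β i j t q +
                  deltaJOM n (d n) (aRand n (d n) ω) α β j i q t) / 2))
    (J := (Fin n × Fin n) × (Fin (d n) × Fin (d n)) × Bool)
    (fun z => badJ n (d n) (1 / α) (1 / β) μ z.1.1 z.1.2 (if z.2.2 then z.2.1.1 else z.2.1.2)
      z.2.1.1 z.2.1.2) (ρ ^ (n - 2))
    (fun z => by
      rw [hρ]
      exact bad_prob n (d n) (hd n) p _ _ μ hp0 hp1 hB hBA hμ hμ0 _ _ _ _ _)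
    (by
      intro ω hω i j hij t q htt hqq htq
      have ha : ∀ i j t q, aRand n (d n) ω i j t q = 1 - 2 * XinRand n (d n) ω i j t q :=
        fun _ _ _ _ => rfl
      rw [ha] at htt hqq htq
      have htt : XinRand n (d n) ω i j t t = 1 := by linarith
      have hqq : XinRand n (d n) ω i j q q = 1 := by linarith
      have htq : XinRand n (d n) ω i j t q = 0 := by linarith
      have hne : t ≠ q := by
        rintro rfl; rw [htt] at htq; norm_num at htq
      have hδ := delta_eq n (d n) (hd n) (aRand n (d n) ω) (XinRand n (d n) ω) ha
        (Xin_good n (d n) ω) α β hα hαβ i j t q htt (by rw [Xin_symm _ _ _ _ _ hij, hqq]) htq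
        (by rw [Xin_symm _ _ _ _ _ hij, htq])
      have hgen : ∀ r, XinRand n (d n) ω i j r r = 1 →
          ¬ badJ n (d n) (1 / α) (1 / β) μ i j r t q ω →
          0 < kappaJOM n (d n) (aRand n (d n) ω) α β i j r +
                (deltaJOM n (d n) (aRand n (d n) ω) α β i j t q +
                  deltaJOM n (d n) (aRand n (d n) ω) α β j i q t) / 2 := by
        intro r hr hbad
        have hκ := kappa_lower n (d n) (hd n) (aRand n (d n) ω) (XinRand n (d n) ω) ha
          (Xin_good n (d n) ω) α β hα hαβ i j hij.ne r hr (by rw [Xin_symm _ _ _ _ _ hij, hr])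
        have hb : ((n : ℝ) - 2) * (μ / 2) <
          ∑ k ∈ Finset.univ.filter (fun k : Fin n => k ≠ i ∧ k ≠ j),
          (KJ (d n) (1 / α) (1 / β) r (XinRand n (d n) ω k i) (XinRand n (d n) ω k j)
          + DJ (d n) (1 / α) (1 / β) t q (XinRand n (d n) ω k i) (XinRand n (d n) ω k j)) := by
          by_contra hc
          exact hbad ⟨hij.ne, hne, not_lt.1 hc⟩
        rw [Finset.sum_add_distrib] at hb
        rw [hδ]
        refine lt_of_lt_of_le ?_ (add_le_add_left hκ _)
        rw [← mul_add]
        refine mul_pos (by positivity) ?_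
        have h5 : 5 * (d n : ℝ) * (1 / α) ≤ μ * n / 8 := by
          have := mul_le_mul_of_nonneg_right hd2 hA.le
          have e : μ * α / 40 * n * (1 / α) = μ * n / 40 := by field_simp
          rw [e] at this
          linarith
        nlinarith
      refine ⟨hgen t htt ?_, hgen q hqq ?_⟩
      · exact hω ((i, j), (t, q), true)
      · have := hω ((i, j), (t, q), false)
        simpa using this)
  refine le_trans ?_ key
  have hcard : (Fintype.card ((Fin n × Fin n) × (Fin (d n) × Fin (d n)) × Bool) : ℝ)
      ≤ 2 * (n : ℝ) ^ 4 := by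
    simp only [Fintype.card_prod, Fintype.card_fin, Fintype.card_bool]
    push_cast
    have hd0 : (0 : ℝ) ≤ d n := by positivity
    have h1 : (d n : ℝ) * d n ≤ n * n := by nlinarith
    have h2 : (0 : ℝ) ≤ n * n := by positivity
    nlinarith [mul_le_mul_of_nonneg_left h1 h2]
  have hpow : ρ ^ (n - 2) = ρ⁻¹ ^ 2 * ρ ^ n := by
    have : n = (n - 2) + 2 := by omega
    conv_rhs => rw [this, pow_add]
    field_simp
  rw [hpow]
  have := mul_le_mul_of_nonneg_right hcard (by positivity : 0 ≤ ρ⁻¹ ^ 2 * ρ ^ n)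
  linarith

end
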